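/- Let r be a positive integer and G an n-vertex graph with minimum degree δ(G) ≥ (1 − 1/r)·n. Then G contains a collection of vertex-disjoint copies of K_r covering all but at most r−1 vertices of G. -/

import Mathlib

namespace HSz
open Finset
open scoped Classical

universe u v

section
variable {V : Type u} {ι : Type v}

/-- `x` has no neighbour in colour class `c`. -/
def Mov (G : SimpleGraph V) (f : V → ι) (x : V) (c : ι) : Prop :=
  ∀ y, f y = c → ¬ G.Adj x y

/-- Edge of the auxiliary digraph. -/
def Step (G : SimpleGraph V) (f : V → ι) (c d : ι) : Prop :=
  ∃ x, f x = c ∧ Mov G f x d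

/-- `a` is reachable from the colour, avoiding `T`. -/
inductive Reach (G : SimpleGraph V) (f : V → ι) (a : ι) (T : Set ι) : ι → Prop
  | base : a ∉ T → Reach G f a T a
  | step {c d : ι} : c ∉ T → Step G f c d → Reach G f a T d → Reach G f a T c

def Proper (G : SimpleGraph V) (f : V → ι) : Prop := ∀ u v, G.Adj u v → f u ≠ f v

variable {G : SimpleGraph V} {f f' : V → ι} {a b c d : ι} {T T' : Set ι}

theorem Reach.notMem (h : Reach G f a T c) : c ∉ T := by
  cases h <;> assumption

theorem Reach.mono (hT : T' ⊆ T) (h : Reach G f a T c) : Reach G f a T' c := by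
  induction h with
  | base h => exact .base fun h' => h (hT h')
  | step h1 h2 _ ih => exact .step (fun h' => h1 (hT h')) h2 ih

theorem Reach.leave_aux {x : ι} (hac : c ≠ a) (h : Reach G f a T x) :
    Reach G f a (insert c T) x ∨ ∃ d, Step G f c d ∧ Reach G f a (insert c T) d := by
  induction h with
  | base h => left; exact .base (by simp [h, hac.symm])
  | @step x d h1 h2 _ ih =>
    rcases ih with ih | ih
    · by_cases hx : x = c
      · subst hx; exact Or.inr ⟨d, h2, ih⟩
      · left; exact .step (by simp [h1, hx]) h2 ih
    · exact Or.inr ih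

theorem Reach.leave (hac : c ≠ a) (h : Reach G f a T c) :
    ∃ d, Step G f c d ∧ Reach G f a (insert c T) d := by
  rcases h.leave_aux hac with h | h
  · exact absurd (Set.mem_insert _ _) h.notMem
  · exact h

theorem Reach.congr (h : Reach G f a T c)
    (hf : ∀ e, Reach G f a T e → ∀ v, f v = e ↔ f' v = e) : Reach G f' a T c := by
  induction h with
  | base h => exact .base h
  | @step x d h1 h2 h3 ih =>
    obtain ⟨y, hy, hm⟩ := h2
    refine .step h1 ⟨y, (hf _ (.step h1 ⟨y, hy, hm⟩ h3) _).1 hy, ?_⟩ ih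
    intro w hw
    exact hm w ((hf _ h3 _).2 hw)

theorem Reach.congr' (h : Reach G f a T c)
    (hf : ∀ e, e ≠ c → Reach G f a T e → ∀ v, f v = e ↔ f' v = e)
    (hc : ∀ v, f v = c → f' v = c) : Reach G f' a T c := by
  by_cases hac : c = a
  · subst hac; exact .base h.notMem
  obtain ⟨d, ⟨x, hx, hm⟩, hd⟩ := h.leave hac
  have hd' : Reach G f' a (insert c T) d := by
    refine hd.congr fun e he v => hf e ?_ (he.mono (Set.subset_insert _ _)) v
    rintro rfl
    exact he.notMem (Set.mem_insert _ _)
  refine .step h.notMem ⟨x, hc x hx, ?_⟩ (hd'.mono (Set.subset_insert _ _))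
  intro w hw
  refine hm w ((hf d ?_ (hd.mono (Set.subset_insert _ _)) w).2 hw)
  rintro rfl
  exact hd.notMem (Set.mem_insert _ _)

variable [Fintype V] [Fintype ι] {s : ℕ}

def Sz (f : V → ι) (a b : ι) (s : ℕ) : Prop :=
  ∀ c, #{v | f v = c} + (if c = a then 1 else 0) = s + (if c = b then 1 else 0)

def Equit (G : SimpleGraph V) (ι : Type v) (s : ℕ) : Prop :=
  ∃ f : V → ι, Proper G f ∧ ∀ c, #{v | f v = c} = s

theorem card_update (f : V → ι) (x : V) (c e : ι) :
    #{v | Function.update f x c v = e} + (if f x = e then 1 else 0)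
      = #{v | f v = e} + (if c = e then 1 else 0) := by
  have h1 : ∀ g : V → ι, #{v | g v = e} = #{v ∈ univ.erase x | g v = e}
      + (if g x = e then 1 else 0) := by
    intro g
    conv_lhs => rw [← insert_erase (mem_univ x), filter_insert]
    split_ifs
    · rw [card_insert_of_notMem (by simp)]
    · simp
  rw [h1 f, h1 (Function.update f x c)]
  have : #{v ∈ univ.erase x | Function.update f x c v = e} = #{v ∈ univ.erase x | f v = e} := by
    congr 1
    apply filter_congr
    intro v hv
    rw [Function.update_of_ne (by simpa using hv)]
  rw [this]; simp; omega

theorem Proper.update (hp : Proper G f) {x : V} (hm : Mov G f x c) :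
    Proper G (Function.update f x c) := by
  intro u v huv
  by_cases hu : u = x
  · subst hu
    have hv : v ≠ u := huv.ne'
    simp only [Function.update_self, Function.update_of_ne hv]
    intro h; exact hm v h.symm huv
  · by_cases hv : v = x
    · subst hv
      simp only [Function.update_self, Function.update_of_ne hu]
      intro h; exact hm u h huv.symm
    · simp only [Function.update_of_ne hu, Function.update_of_ne hv]
      exact hp u v huv

theorem shift (n : ℕ) : ∀ (T : Set ι) (f : V → ι) (b : ι), #{c | c ∉ T} = n →
    Proper G f → Sz f a b s → Reach G f a T b → Equit G ι s := by
  induction n using Nat.strong_induction_on with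
  | _ n ih =>
  intro T f b hn hp hs hr
  by_cases hab : b = a
  · subst hab
    exact ⟨f, hp, fun c => by have := hs c; omega⟩
  obtain ⟨c, ⟨y, hy, hm⟩, hc⟩ := hr.leave hab
  have hcb : c ≠ b := by
    rintro rfl
    exact hc.notMem (Set.mem_insert _ _)
  refine ih _ ?_ (insert b T) (Function.update f y c) c rfl
    (hp.update hm) ?_ ?_
  · rw [← hn]
    apply card_lt_card
    refine ⟨?_, ?_⟩
    · intro e; simp
    · intro h
      have := h (show b ∈ _ by simp [hr.notMem])
      simp at this
  · intro e
    have h1 := card_update f y c e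
    have h2 := hs e
    rw [hy] at h1
    rw [eq_comm (a := b), eq_comm (a := c)] at h1
    omega
  · refine hc.congr' ?_ ?_
    · intro e hec he v
      by_cases hv : v = y
      · subst hv
        simp only [Function.update_self, hy]
        constructor
        · rintro rfl; exact absurd (Set.mem_insert _ _) he.notMem
        · rintro rfl; exact absurd rfl hec
      · rw [Function.update_of_ne hv]
    · intro v hv
      rw [Function.update_of_ne]
      · exact hv
      · rintro rfl; exact hcb (hv.symm.trans hy)

end

section
variable {V : Type u} {ι : Type v} [Fintype V] [Fintype ι]
variable {G : SimpleGraph V} {f : V → ι} {a b : ι} {s : ℕ}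

/-- accessible colours -/
noncomputable def acc (G : SimpleGraph V) (f : V → ι) (a : ι) : Finset ι :=
  {c | Reach G f a ∅ c}

theorem mem_acc {c : ι} : c ∈ acc G f a ↔ Reach G f a ∅ c := by simp [acc]

theorem a_mem_acc : a ∈ acc G f a := mem_acc.2 (.base (by simp))

/-- colours blocked by `U` -/
noncomputable def blk (G : SimpleGraph V) (f : V → ι) (a U : ι) : Finset ι :=
  {c | c ∈ acc G f a ∧ c ≠ U ∧ ¬ Reach G f a {U} c}

theorem mem_blk {c U : ι} :
    c ∈ blk G f a U ↔ c ∈ acc G f a ∧ c ≠ U ∧ ¬ Reach G f a {U} c := by simp [blk]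

theorem blk_transfer {U W d : ι} (hW : W ∈ blk G f a U) (h : Reach G f a {U} d) :
    Reach G f a {W} d := by
  have hW' := (mem_blk.1 hW).2.2
  induction h with
  | base h =>
    refine .base ?_
    rintro rfl
    exact hW' (.base h)
  | step h1 h2 h3 ih =>
    refine .step ?_ h2 ih
    rintro rfl
    exact hW' (.step h1 h2 h3)

theorem not_reach_self {c : ι} : ¬ Reach G f a {a} c := by
  intro h
  induction h with
  | base h => exact h rfl
  | step _ _ _ ih => exact ih

theorem exists_terminal (h : ∃ c ∈ acc G f a, c ≠ a) :
    ∃ (U : ι) (A' : Finset ι), A'.Nonempty ∧ A' ⊆ acc G f a ∧ U ∈ acc G f a ∧ U ∉ A' ∧ a ∉ A' ∧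
      (∀ W ∈ A', ∀ c ∈ acc G f a, c ≠ W → Reach G f a {W} c) ∧
      (∀ x, f x ∈ A' → ∀ c ∈ acc G f a, c ≠ U → c ∉ A' → ¬ Mov G f x c) := by
  have hne : (({U | U ∈ acc G f a ∧ (blk G f a U).Nonempty} : Finset ι)).Nonempty := by
    obtain ⟨c, hc, hca⟩ := h
    exact ⟨a, by simpa using ⟨a_mem_acc, c, mem_blk.2 ⟨hc, hca, not_reach_self⟩⟩⟩
  obtain ⟨U, hU, hmin⟩ := exists_min_image _ (fun U => #(blk G f a U)) hne
  simp only [mem_filter, mem_univ, true_and] at hU hmin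
  have haU : a ∉ blk G f a U := by
    intro h
    obtain ⟨_, h2, h3⟩ := mem_blk.1 h
    exact h3 (.base (by simpa using h2))
  refine ⟨U, blk G f a U, hU.2, fun c hc => (mem_blk.1 hc).1, hU.1,
    fun h => (mem_blk.1 h).2.1 rfl, haU, ?_, ?_⟩
  · intro W hW c hc hcW
    by_contra hcon
    have hWm := mem_blk.1 hW
    have hle := hmin W ⟨hWm.1, c, mem_blk.2 ⟨hc, hcW, hcon⟩⟩
    refine absurd hle (not_le.2 (card_lt_card ⟨?_, ?_⟩))
    · intro e he
      obtain ⟨he1, he2, he3⟩ := mem_blk.1 he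
      refine mem_blk.2 ⟨he1, ?_, fun h => he3 (blk_transfer hW h)⟩
      rintro rfl
      apply he3
      by_cases hea : e = a
      · subst hea; exact .base (by simpa using he2)
      · obtain ⟨d, hd1, hd2⟩ := (mem_acc.1 he1).leave hea
        refine .step (by simpa using he2) hd1 (blk_transfer hW (by simpa using hd2))
    · intro h
      exact (mem_blk.1 (h hW)).2.1 rfl
  · intro x hx c hc hcU hcA hm
    have hx' := mem_blk.1 hx
    apply hx'.2.2
    refine .step (by simpa using hx'.2.1) ⟨x, rfl, hm⟩ ?_
    by_contra hcon
    exact hcA (mem_blk.2 ⟨hc, hcU, hcon⟩)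

/-- neighbours of `x` coloured in `P` -/
noncomputable def nb (G : SimpleGraph V) (f : V → ι) (x : V) (P : Finset ι) : Finset V :=
  {y | f y ∈ P ∧ G.Adj x y}

theorem mem_nb {x y : V} {P : Finset ι} : y ∈ nb G f x P ↔ f y ∈ P ∧ G.Adj x y := by
  simp [nb]

theorem le_nb {x : V} {P : Finset ι} (h : ∀ c ∈ P, ¬ Mov G f x c) : #P ≤ #(nb G f x P) := by
  have : P ⊆ (nb G f x P).image f := by
    intro c hc
    have := h c hc
    unfold Mov at this
    push Not at this
    obtain ⟨y, hy, hxy⟩ := this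
    exact mem_image.2 ⟨y, mem_nb.2 ⟨hy ▸ hc, hxy⟩, hy⟩
  exact (card_le_card this).trans card_image_le

theorem nb_add {x : V} {P Q : Finset ι} (h : Disjoint P Q) :
    #(nb G f x P) + #(nb G f x Q) ≤ #{y | G.Adj x y} := by
  rw [← card_union_of_disjoint]
  · apply card_le_card
    intro y; simp only [mem_union, mem_nb, mem_filter, mem_univ, true_and]; tauto
  · rw [disjoint_left]
    intro y h1 h2
    exact disjoint_left.1 h (mem_nb.1 h1).1 (mem_nb.1 h2).1

/-- an inaccessible vertex is not movable to an accessible class -/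
theorem not_mov {y : V} (hy : f y ∉ acc G f a) {c : ι} (hc : c ∈ acc G f a) : ¬ Mov G f y c :=
  fun h => hy (mem_acc.2 (.step (by simp) ⟨y, rfl, h⟩ (mem_acc.1 hc)))

theorem sum_swap (P Q : Finset V) (w : V → V → ℕ) :
    ∑ y ∈ P, ∑ z ∈ Q with G.Adj y z, w y z = ∑ z ∈ Q, ∑ y ∈ P with G.Adj z y, w y z := by
  simp only [sum_filter]
  rw [sum_comm]
  simp only [G.adj_comm]

theorem card_pre (P : Finset ι) : #{v | f v ∈ P} = ∑ c ∈ P, #{v | f v = c} := by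
  rw [card_eq_sum_card_fiberwise (f := f) (t := P) (by intro v; simp)]
  apply sum_congr rfl
  intro c hc
  congr 1
  ext v
  simp only [mem_filter, mem_univ, true_and]
  constructor
  · exact fun h => h.2
  · rintro rfl; exact ⟨hc, rfl⟩

theorem card_inacc (hs : Sz f a b s) (hb : b ∉ acc G f a) :
    #{v | f v ∉ acc G f a} = #(acc G f a)ᶜ * s + 1 := by
  have h := card_pre (f := f) (acc G f a)ᶜ
  simp only [mem_compl] at h
  rw [h]
  have h2 : ∀ c ∈ (acc G f a)ᶜ, #{v | f v = c} = s + if c = b then 1 else 0 := by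
    intro c hc
    have h3 := hs c
    have : c ≠ a := by rintro rfl; exact (mem_compl.1 hc) a_mem_acc
    simpa [this] using h3
  rw [sum_congr rfl h2, sum_add_distrib]
  simp [hb]

theorem exists_ne_a (hs : Sz f a b s) (hb : b ∉ acc G f a)
    (hΔ : ∀ x, #{y | G.Adj x y} < Fintype.card ι) : ∃ c ∈ acc G f a, c ≠ a := by
  by_contra! hcon
  have hA : acc G f a = {a} := by
    ext c; simp only [mem_singleton]
    exact ⟨hcon c, by rintro rfl; exact a_mem_acc⟩
  have h1 := card_inacc hs hb
  have hba : b ≠ a := by rintro rfl; exact hb a_mem_acc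
  have h2 : #{v | f v = a} + 1 = s := by
    have := hs a; simpa [hba.symm] using this
  have h3 := sum_swap (G := G) {v | f v ∉ acc G f a} {v | f v = a} (fun _ _ => 1)
  have h4 : #{v | f v ∉ acc G f a} ≤
      ∑ y ∈ {v | f v ∉ acc G f a}, ∑ z ∈ {v | f v = a} with G.Adj y z, 1 := by
    rw [card_eq_sum_ones]
    apply sum_le_sum
    intro y hy
    have := not_mov (by simpa using hy) (a_mem_acc (G := G) (f := f) (a := a))
    unfold Mov at this
    push Not at this
    obtain ⟨z, hz, hyz⟩ := this
    rw [← card_eq_sum_ones]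
    exact card_pos.2 ⟨z, by simp [hz, hyz]⟩
  have h5 : ∑ z ∈ {v | f v = a}, ∑ y ∈ {v | f v ∉ acc G f a} with G.Adj z y, 1
      ≤ #{v | f v = a} * (Fintype.card ι - 1) := by
    rw [← smul_eq_mul]
    apply sum_le_card_nsmul
    intro z _
    rw [← card_eq_sum_ones]
    have : #{y ∈ ({v | f v ∉ acc G f a} : Finset V) | G.Adj z y} ≤ #{y | G.Adj z y} :=
      card_le_card (by intro y; simp)
    have := hΔ z
    omega
  rw [card_compl, hA, card_singleton] at h1
  rw [hA] at h3 h4 h5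
  have : #{v | f v = a} * (Fintype.card ι - 1) ≤ (Fintype.card ι - 1) * s := by
    rw [mul_comm]; gcongr; omega
  omega

end

section
variable {V : Type u} {ι : Type v} [Fintype V] [Fintype ι]
variable {G : SimpleGraph V} {f : V → ι} {a b U : ι} {s : ℕ} {A' : Finset ι}

def Solo (G : SimpleGraph V) (f : V → ι) (a : ι) (A' : Finset ι) (z y : V) : Prop :=
  f z ∈ A' ∧ f y ∉ acc G f a ∧ G.Adj z y ∧ ∀ z', f z' = f z → G.Adj z' y → z' = z

theorem deg_inacc (hΔ : ∀ x, #{y | G.Adj x y} < Fintype.card ι) {y : V}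
    (hy : f y ∉ acc G f a) : #(nb G f y (acc G f a)ᶜ) + 1 ≤ #(acc G f a)ᶜ := by
  have h1 := le_nb (G := G) (f := f) (x := y) (P := acc G f a) fun c hc => not_mov hy hc
  have h2 := nb_add (G := G) (f := f) (x := y) (disjoint_compl_right (a := acc G f a))
  have h3 := hΔ y
  have h4 := card_add_card_compl (acc G f a)
  omega

theorem solo_count (hΔ : ∀ x, #{y | G.Adj x y} < Fintype.card ι) (hA : A' ⊆ acc G f a) {y : V}
    (hy : f y ∉ acc G f a) :
    #A' + 1 + #(nb G f y (acc G f a)ᶜ) ≤ #{z | Solo G f a A' z y} + #(acc G f a)ᶜ := by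
  set M : Finset ι := {c ∈ A' | ¬ ∃ z, f z = c ∧ Solo G f a A' z y} with hM
  have hMA : M ⊆ acc G f a := (filter_subset _ _).trans hA
  have h1 : #A' ≤ #M + #{z | Solo G f a A' z y} := by
    have : A' ⊆ M ∪ ({z | Solo G f a A' z y} : Finset V).image f := by
      intro c hc
      by_cases h : ∃ z, f z = c ∧ Solo G f a A' z y
      · obtain ⟨z, hz, hs⟩ := h
        exact mem_union_right _ (mem_image.2 ⟨z, by simpa using hs, hz⟩)
      · exact mem_union_left _ (mem_filter.2 ⟨hc, h⟩)
    have h2 := card_le_card this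
    have h3 := card_union_le M (({z | Solo G f a A' z y} : Finset V).image f)
    have h4 := card_image_le (s := ({z | Solo G f a A' z y} : Finset V)) (f := f)
    omega
  have h2 : #(acc G f a) + #M ≤ #(nb G f y (acc G f a)) := by
    have e1 : #(nb G f y (acc G f a)) =
        ∑ c ∈ acc G f a, #{v ∈ nb G f y (acc G f a) | f v = c} :=
      card_eq_sum_card_fiberwise (by intro v hv; exact (mem_nb.1 hv).1)
    have e2 : #(acc G f a) + #M = ∑ c ∈ acc G f a, (1 + if c ∈ M then 1 else 0) := by
      rw [sum_add_distrib, ← card_eq_sum_ones, sum_ite_mem, inter_eq_right.2 hMA]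
      simp
    rw [e1, e2]
    apply sum_le_sum
    intro c hc
    have := not_mov hy hc
    unfold Mov at this
    push Not at this
    obtain ⟨z, hz, hyz⟩ := this
    have hzm : z ∈ ({v ∈ nb G f y (acc G f a) | f v = c} : Finset V) :=
      mem_filter.2 ⟨mem_nb.2 ⟨hz ▸ hc, hyz⟩, hz⟩
    split_ifs with hcM
    · obtain ⟨hcA, hns⟩ := mem_filter.1 hcM
      have : ¬ Solo G f a A' z y := fun h => hns ⟨z, hz, h⟩
      have h3 : ∃ z', f z' = f z ∧ G.Adj z' y ∧ z' ≠ z := by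
        by_contra! hcon
        exact this ⟨hz ▸ hcA, hy, hyz.symm, hcon⟩
      obtain ⟨z', h4, h5, h6⟩ := h3
      have : 1 < #{v ∈ nb G f y (acc G f a) | f v = c} := by
        rw [one_lt_card]
        exact ⟨z', mem_filter.2 ⟨mem_nb.2 ⟨by rw [h4, hz]; exact hc, h5.symm⟩, h4.trans hz⟩,
          z, hzm, h6⟩
      omega
    · exact card_pos.2 ⟨z, hzm⟩
  have h3 := nb_add (G := G) (f := f) (x := y) (disjoint_compl_right (a := acc G f a))
  have h4 := hΔ y
  have h5 := card_add_card_compl (acc G f a)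
  omega

theorem lemma2 (hΔ : ∀ x, #{y | G.Adj x y} < Fintype.card ι) (hs : Sz f a b s)
    (hb : b ∉ acc G f a) (hA : A' ⊆ acc G f a) (hU : U ∈ acc G f a) (hUA : U ∉ A') (haA : a ∉ A')
    (hA2 : ∀ x, f x ∈ A' → ∀ c ∈ acc G f a, c ≠ U → c ∉ A' → ¬ Mov G f x c)
    {W : ι} (hW : W ∈ A')
    (hns : ∀ z, f z = W → (∃ y, Solo G f a A' z y) → ∀ c ∈ acc G f a, c ≠ W → ¬ Mov G f z c) :
    #(acc G f a)ᶜ + 1 ≤ #A' := by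
  set q := #(acc G f a)ᶜ with hq
  have hcard := card_add_card_compl (acc G f a)
  have hWs : #{z | f z = W} = s := by
    have := hs W
    have h1 : W ≠ a := by rintro rfl; exact haA hW
    have h2 : W ≠ b := by rintro rfl; exact hb (hA hW)
    simpa [h1, h2] using this
  set w : V → ℕ := fun z => if ∃ y, Solo G f a A' z y then 2 else 1 with hw
  have hsw := sum_swap (G := G) {v | f v ∉ acc G f a} {v | f v = W} (fun _ z => w z)
  have hlow : #{v | f v ∉ acc G f a} * 2 ≤
      ∑ y ∈ {v | f v ∉ acc G f a}, ∑ z ∈ {v | f v = W} with G.Adj y z, w z := by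
    rw [← smul_eq_mul]
    apply card_nsmul_le_sum
    intro y hy
    have hy' : f y ∉ acc G f a := by simpa using hy
    have := not_mov hy' (hA hW)
    unfold Mov at this
    push Not at this
    obtain ⟨z, hz, hyz⟩ := this
    have hzm : z ∈ ({v ∈ ({v | f v = W} : Finset V) | G.Adj y v} : Finset V) := by
      simp [hz, hyz]
    by_cases hz2 : ∃ y, Solo G f a A' z y
    · have h1 := single_le_sum (f := w) (fun i _ => Nat.zero_le (w i)) hzm
      have h2 : w z = 2 := by simp only [hw]; rw [if_pos hz2]
      omega
    · have h3 : ∃ z', f z' = f z ∧ G.Adj z' y ∧ z' ≠ z := by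
        by_contra! hcon
        exact hz2 ⟨y, hz ▸ hW, hy', hyz.symm, hcon⟩
      obtain ⟨z', h4, h5, h6⟩ := h3
      have h7 : 1 < #{v ∈ ({v | f v = W} : Finset V) | G.Adj y v} := by
        rw [one_lt_card]
        exact ⟨z', by simp [h4, hz, h5.symm], z, hzm, h6⟩
      have h8 : #{v ∈ ({v | f v = W} : Finset V) | G.Adj y v} ≤
          ∑ z ∈ {v | f v = W} with G.Adj y z, w z := by
        rw [card_eq_sum_ones]
        apply sum_le_sum
        intro i _
        simp only [hw]; split_ifs <;> omega
      omega
  have hup : ∀ z ∈ ({v | f v = W} : Finset V),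
      ∑ y ∈ {v | f v ∉ acc G f a} with G.Adj z y, w z ≤
        if ∃ y, Solo G f a A' z y then 2 * q else q + #A' := by
    intro z hz
    have hzW : f z = W := by simpa using hz
    rw [sum_const, smul_eq_mul]
    have e : ({y ∈ ({v | f v ∉ acc G f a} : Finset V) | G.Adj z y} : Finset V)
        = nb G f z (acc G f a)ᶜ := by
      ext y; simp [mem_nb]
    rw [e]
    have hd := hΔ z
    split_ifs with hz2
    · have h1 := le_nb (G := G) (f := f) (x := z) (P := (acc G f a).erase W)
        fun c hc => hns z hzW hz2 c (mem_of_mem_erase hc) (ne_of_mem_erase hc)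
      have h2 := nb_add (G := G) (f := f) (x := z)
        (disjoint_compl_right.mono_left (erase_subset W (acc G f a)))
      rw [card_erase_of_mem (hA hW)] at h1
      have : 0 < #(acc G f a) := card_pos.2 ⟨_, hA hW⟩
      have h2 : w z = 2 := by simp only [hw]; rw [if_pos hz2]
      rw [h2]
      omega
    · have h1 := le_nb (G := G) (f := f) (x := z) (P := (acc G f a) \ insert U A')
        fun c hc => by
          simp only [mem_sdiff, mem_insert, not_or] at hc
          exact hA2 z (hzW ▸ hW) c hc.1 hc.2.1 hc.2.2
      have h2 := nb_add (G := G) (f := f) (x := z)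
        (disjoint_compl_right.mono_left (sdiff_subset (s := acc G f a) (t := insert U A')))
      rw [card_sdiff_of_subset (insert_subset hU hA), card_insert_of_notMem hUA] at h1
      have h3 := card_le_card (insert_subset hU hA)
      rw [card_insert_of_notMem hUA] at h3
      have h2 : w z = 1 := by simp only [hw]; rw [if_neg hz2]
      rw [h2]
      omega
  have hup2 := sum_le_sum hup
  rw [← hsw] at hup2
  rw [card_inacc hs hb, ← hq] at hlow
  by_contra hcon
  have hfin : ∑ z ∈ ({v | f v = W} : Finset V),
      (if ∃ y, Solo G f a A' z y then 2 * q else q + #A') ≤ s * (2 * q) := by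
    refine (sum_le_card_nsmul _ _ (2 * q) ?_).trans (by rw [hWs, smul_eq_mul])
    intro z _
    split_ifs <;> omega
  have := hlow.trans (hup2.trans hfin)
  nlinarith

theorem lemma4 (hΔ : ∀ x, #{y | G.Adj x y} < Fintype.card ι) (hs : Sz f a b s)
    (hb : b ∉ acc G f a) (hA : A' ⊆ acc G f a) (hU : U ∈ acc G f a) (hUA : U ∉ A') (haA : a ∉ A')
    (hA2 : ∀ x, f x ∈ A' → ∀ c ∈ acc G f a, c ≠ U → c ∉ A' → ¬ Mov G f x c)
    (hne : A'.Nonempty) :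
    ∃ z y₁, Solo G f a A' z y₁ ∧ ((∃ c ∈ acc G f a, c ≠ f z ∧ Mov G f z c) ∨
      ((∀ c ∈ acc G f a, c ≠ f z → ¬ Mov G f z c) ∧
        ∃ y₂, Solo G f a A' z y₂ ∧ y₂ ≠ y₁ ∧ ¬ G.Adj y₁ y₂)) := by
  by_contra! hcon
  have hmv : ∀ z y, Solo G f a A' z y → ∀ c ∈ acc G f a, c ≠ f z → ¬ Mov G f z c :=
    fun z y h => (hcon z y h).1
  have hcl : ∀ z y₁ y₂, Solo G f a A' z y₁ → Solo G f a A' z y₂ → y₂ ≠ y₁ → G.Adj y₁ y₂ :=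
    fun z y₁ y₂ h1 h2 h3 => (hcon z y₁ h1).2 (hmv z y₁ h1) y₂ h2 h3
  obtain ⟨W, hW⟩ := hne
  have hqt := lemma2 hΔ hs hb hA hU hUA haA hA2 hW (by
    rintro z rfl ⟨y, hy⟩
    exact hmv z y hy)
  set q := #(acc G f a)ᶜ with hq
  set t := #A' with ht
  set S : V → Finset V := fun z => {y | Solo G f a A' z y} with hS
  have hcA : #{z | f z ∈ A'} = t * s := by
    rw [card_pre, ht, ← smul_eq_mul, ← sum_const]
    apply sum_congr rfl
    intro c hc
    have := hs c
    have h1 : c ≠ a := by rintro rfl; exact haA hc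
    have h2 : c ≠ b := by rintro rfl; exact hb (hA hc)
    simpa [h1, h2] using this
  have hup : ∑ z ∈ {z | f z ∈ A'}, ∑ y ∈ S z, (q : ℚ) / #(S z) ≤ (t * s : ℕ) * q := by
    rw [← hcA, ← nsmul_eq_mul]
    apply sum_le_card_nsmul
    intro z _
    rw [sum_const, nsmul_eq_mul]
    by_cases h0 : (#(S z) : ℚ) = 0
    · rw [h0]; simp
    · rw [mul_div_cancel₀ _ h0]
  have hswap : ∑ z ∈ {z | f z ∈ A'}, ∑ y ∈ S z, (q : ℚ) / #(S z) =
      ∑ y ∈ {y | f y ∉ acc G f a}, ∑ z ∈ {z | Solo G f a A' z y}, (q : ℚ) / #(S z) := by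
    apply sum_comm'
    intro z y
    simp only [hS, mem_filter, mem_univ, true_and]
    exact ⟨fun h => ⟨h.2, h.2.2.1⟩, fun h => ⟨h.1.1, h.1⟩⟩
  have hlow : (#{v | f v ∉ acc G f a} : ℕ) * (t : ℚ) ≤
      ∑ y ∈ {y | f y ∉ acc G f a}, ∑ z ∈ {z | Solo G f a A' z y}, (q : ℚ) / #(S z) := by
    rw [← nsmul_eq_mul]
    apply card_nsmul_le_sum
    intro y hy
    have hy' : f y ∉ acc G f a := by simpa using hy
    have h1 := solo_count hΔ hA hy'
    have h2 := deg_inacc hΔ hy'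
    rw [← hq] at h1 h2
    rw [← ht] at h1
    set δ := #(nb G f y (acc G f a)ᶜ) with hδ
    have h3 : (#{z | Solo G f a A' z y} : ℚ) * ((q : ℚ) / (δ + 1)) ≤
        ∑ z ∈ {z | Solo G f a A' z y}, (q : ℚ) / #(S z) := by
      rw [← nsmul_eq_mul]
      apply card_nsmul_le_sum
      intro z hz
      have hz' : Solo G f a A' z y := by simpa using hz
      have hyS : y ∈ S z := by simpa [hS] using hz'
      have h4 : #(S z) ≤ δ + 1 := by
        have : (S z).erase y ⊆ nb G f y (acc G f a)ᶜ := by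
          intro y' hy2
          obtain ⟨h5, h6⟩ := mem_erase.1 hy2
          have h7 : Solo G f a A' z y' := by simpa [hS] using h6
          exact mem_nb.2 ⟨mem_compl.2 h7.2.1, hcl z y y' hz' h7 h5⟩
        have := card_le_card this
        rw [card_erase_of_mem hyS] at this
        omega
      have h5 : 0 < #(S z) := card_pos.2 ⟨y, hyS⟩
      have h4' : (#(S z) : ℚ) ≤ δ + 1 := by exact_mod_cast h4
      have h5' : (0 : ℚ) < #(S z) := by exact_mod_cast h5
      gcongr
    refine le_trans ?_ h3
    have h1' : (t : ℚ) + 1 + δ ≤ #{z | Solo G f a A' z y} + q := by exact_mod_cast h1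
    have h2' : (δ : ℚ) + 1 ≤ q := by exact_mod_cast h2
    have h6 : (q : ℚ) + 1 ≤ t := by exact_mod_cast hqt
    have h7 : (0 : ℚ) ≤ δ := by positivity
    rw [← mul_div_assoc, le_div_iff₀ (by linarith)]
    nlinarith [mul_nonneg (sub_nonneg.2 h1') (h7.trans (by linarith : (δ : ℚ) ≤ q)),
      mul_nonneg (sub_nonneg.2 h2') (by linarith : (0 : ℚ) ≤ t - q)]
  rw [← hswap] at hlow
  have := hlow.trans hup
  rw [card_inacc hs hb, ← hq] at this
  have h8 : (q * s + 1) * t ≤ t * s * q := by exact_mod_cast this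
  nlinarith

end

section
variable {V : Type u} {ι : Type v} [Fintype V] [Fintype ι]
variable {G : SimpleGraph V} {f : V → ι} {A' : Finset ι} {a b : ι} {s : ℕ}

/-- the theorem for fewer colours, on vertex subsets -/
def SubHS (G : SimpleGraph V) (ι : Type v) [Fintype ι] (s : ℕ) : Prop :=
  ∀ Q : Finset ι, Q ≠ univ → ∀ X : Finset V, #X = #Q * s →
    (∀ v ∈ X, #{w ∈ X | G.Adj v w} < #Q) →
    ∃ g : V → ι, (∀ v ∈ X, g v ∈ Q) ∧ (∀ v ∈ X, ∀ w ∈ X, G.Adj v w → g v ≠ g w) ∧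
      ∀ c ∈ Q, #{v ∈ X | g v = c} = s

noncomputable def recol (G : SimpleGraph V) (f : V → ι) (a : ι) (g : V → ι) (z y : V) : V → ι :=
  fun v => if f v ∈ acc G f a then f v else if v = y then f z else g v

theorem recol_acc {g : V → ι} {z y v : V} (h : f v ∈ acc G f a) : recol G f a g z y v = f v := by
  simp [recol, h]

theorem recol_y {g : V → ι} {z y : V} (h : f y ∉ acc G f a) : recol G f a g z y y = f z := by
  simp [recol, h]

theorem recol_B {g : V → ι} {z y v : V} (h : f v ∉ acc G f a) (hv : v ≠ y) :
    recol G f a g z y v = g v := by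
  simp [recol, h, hv]

theorem recol_main (hs : Sz f a b s) (hp : Proper G f) (hb : b ∉ acc G f a)
    (hA : A' ⊆ acc G f a) {z y : V} (hzy : Solo G f a A' z y) {g : V → ι}
    (hg1 : ∀ v, f v ∉ acc G f a → v ≠ y → g v ∉ acc G f a)
    (hg2 : ∀ v w, f v ∉ acc G f a → v ≠ y → f w ∉ acc G f a → w ≠ y → G.Adj v w → g v ≠ g w)
    (hg3 : ∀ c, c ∉ acc G f a → #{v | (f v ∉ acc G f a ∧ v ≠ y) ∧ g v = c} = s)
    {c : ι} (hc : Mov G (recol G f a g z y) z c) :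
    Proper G (Function.update (recol G f a g z y) z c) ∧
      Sz (Function.update (recol G f a g z y) z c) a c s := by
  obtain ⟨hzA, hyB, hadj, hsolo⟩ := hzy
  have hzacc := hA hzA
  constructor
  · have key : ∀ u v, u ≠ z → v ≠ z → G.Adj u v → f u ∈ acc G f a →
        recol G f a g z y u ≠ recol G f a g z y v := by
      intro u v hu hv huv hu2
      rw [recol_acc hu2]
      by_cases hv2 : f v ∈ acc G f a
      · rw [recol_acc hv2]; exact hp u v huv
      · by_cases hvy : v = y
        · subst hvy
          rw [recol_y hv2]
          intro h
          exact hu (hsolo u h huv)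
        · rw [recol_B hv2 hvy]
          intro h
          exact hg1 v hv2 hvy (h ▸ hu2)
    intro u v huv
    by_cases hu : u = z
    · subst hu
      rw [Function.update_self, Function.update_of_ne huv.ne']
      intro h; exact hc v h.symm huv
    by_cases hv : v = z
    · subst hv
      rw [Function.update_self, Function.update_of_ne huv.ne]
      intro h; exact hc u h huv.symm
    rw [Function.update_of_ne hu, Function.update_of_ne hv]
    by_cases hu2 : f u ∈ acc G f a
    · exact key u v hu hv huv hu2
    by_cases hv2 : f v ∈ acc G f a
    · exact (key v u hv hu huv.symm hv2).symm
    by_cases huy : u = y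
    · subst huy
      rw [recol_y hu2, recol_B hv2 huv.ne']
      intro h
      exact hg1 v hv2 huv.ne' (h ▸ hzacc)
    by_cases hvy : v = y
    · subst hvy
      rw [recol_y hv2, recol_B hu2 huv.ne]
      intro h
      exact hg1 u hu2 huv.ne (h ▸ hzacc)
    rw [recol_B hu2 huy, recol_B hv2 hvy]
    exact hg2 u v hu2 huy hv2 hvy huv
  · intro e
    have h1 := card_update (recol G f a g z y) z c e
    rw [recol_acc hzacc] at h1
    have h2 := hs e
    rw [eq_comm (a := c)] at h1
    by_cases he : e ∈ acc G f a
    · have heb : e ≠ b := by rintro rfl; exact hb he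
      rw [if_neg heb] at h2
      have h3 : #{v | recol G f a g z y v = e} = #{v | f v = e} + if f z = e then 1 else 0 := by
        split_ifs with hze
        · have : ({v | recol G f a g z y v = e} : Finset V) =
              insert y ({v | f v = e} : Finset V) := by
            ext v
            simp only [mem_filter, mem_univ, true_and, mem_insert]
            by_cases hv2 : f v ∈ acc G f a
            · rw [recol_acc hv2]
              constructor
              · exact Or.inr
              · rintro (rfl | h)
                · exact absurd hv2 hyB
                · exact h
            · by_cases hvy : v = y
              · subst hvy; simp [recol_y hyB, hze]
              · rw [recol_B hv2 hvy]
                constructor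
                · rintro rfl; exact absurd he (hg1 v hv2 hvy)
                · rintro (h | rfl)
                  · exact absurd h hvy
                  · exact absurd he hv2
          rw [this, card_insert_of_notMem]
          simp only [mem_filter, mem_univ, true_and]
          rintro rfl; exact hyB he
        · rw [add_zero]
          congr 1
          ext v
          simp only [mem_filter, mem_univ, true_and]
          by_cases hv2 : f v ∈ acc G f a
          · rw [recol_acc hv2]
          · have : f v ≠ e := by rintro rfl; exact hv2 he
            by_cases hvy : v = y
            · subst hvy; simp [recol_y hyB, hze, this]
            · rw [recol_B hv2 hvy]
              have : g v ≠ e := by rintro rfl; exact hg1 v hv2 hvy he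
              simp [*]
      omega
    · have hea : e ≠ a := by rintro rfl; exact he a_mem_acc
      have hez : f z ≠ e := by rintro rfl; exact he hzacc
      have h3 : #{v | recol G f a g z y v = e} = s := by
        rw [← hg3 e he]
        congr 1
        ext v
        simp only [mem_filter, mem_univ, true_and]
        by_cases hv2 : f v ∈ acc G f a
        · rw [recol_acc hv2]
          have : f v ≠ e := by rintro rfl; exact he hv2
          simp [*]
        · by_cases hvy : v = y
          · subst hvy; simp [recol_y hyB, hez]
          · rw [recol_B hv2 hvy]; simp [*]
      rw [if_neg hez] at h1
      rw [if_neg hea]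
      omega

theorem nearly (hΔ : ∀ x, #{y | G.Adj x y} < Fintype.card ι) (hsub : SubHS G ι s) (n : ℕ) :
    ∀ (f : V → ι) (b : ι), #(acc G f a)ᶜ = n → Proper G f → Sz f a b s → Equit G ι s := by
  induction n using Nat.strong_induction_on with
  | _ n ih =>
  intro f b hn hp hs
  by_cases hb : b ∈ acc G f a
  · exact shift _ ∅ f b rfl hp hs (mem_acc.1 hb)
  obtain ⟨U, A', hne, hA, hU, hUA, haA, hterm, hA2⟩ := exists_terminal (exists_ne_a hs hb hΔ)
  obtain ⟨z, y, hzy, hcase⟩ := lemma4 hΔ hs hb hA hU hUA haA hA2 hne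
  obtain ⟨hzA, hyB, hadj, hsolo⟩ := id hzy
  have hzacc := hA hzA
  have hza : f z ≠ a := by intro h; exact haA (h ▸ hzA)
  set X : Finset V := {v | f v ∉ acc G f a ∧ v ≠ y} with hX
  have hXm : ∀ v, v ∈ X ↔ f v ∉ acc G f a ∧ v ≠ y := by intro v; simp [hX]
  have hXc : #X = #(acc G f a)ᶜ * s := by
    have h1 := card_inacc hs hb
    have h2 : X = ({v | f v ∉ acc G f a} : Finset V).erase y := by
      ext v; simp [hX, and_comm]
    rw [h2, card_erase_of_mem (by simpa using hyB), h1]; rfl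
  obtain ⟨g, hg1, hg2, hg3⟩ := hsub (acc G f a)ᶜ (by
      intro h
      have := mem_univ a
      rw [← h] at this
      exact mem_compl.1 this a_mem_acc) X hXc (by
      intro v hv
      have h1 := deg_inacc hΔ ((hXm v).1 hv).1
      have h2 : #{w ∈ X | G.Adj v w} ≤ #(nb G f v (acc G f a)ᶜ) := by
        apply card_le_card
        intro w hw
        rw [mem_filter, hXm] at hw
        exact mem_nb.2 ⟨mem_compl.2 hw.1.1, hw.2⟩
      omega)
  have hg1' : ∀ v, f v ∉ acc G f a → v ≠ y → g v ∉ acc G f a :=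
    fun v h1 h2 => mem_compl.1 (hg1 v ((hXm v).2 ⟨h1, h2⟩))
  have hg3' : ∀ c, c ∉ acc G f a → #{v | (f v ∉ acc G f a ∧ v ≠ y) ∧ g v = c} = s := by
    intro c hc
    rw [← hg3 c (mem_compl.2 hc)]
    congr 1
    ext v
    simp [hXm]
  have hmain := fun c (hc : Mov G (recol G f a g z y) z c) =>
    recol_main hs hp hb hA hzy hg1' (fun v w h1 h2 h3 h4 =>
      hg2 v ((hXm v).2 ⟨h1, h2⟩) w ((hXm w).2 ⟨h3, h4⟩)) hg3' hc
  have hsame : ∀ c e, e ≠ c → e ≠ f z → e ∈ acc G f a →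
      ∀ v, f v = e ↔ Function.update (recol G f a g z y) z c v = e := by
    intro c e hec hez he v
    by_cases hvz : v = z
    · subst hvz
      rw [Function.update_self]
      exact ⟨fun h => absurd h.symm hez, fun h => absurd h.symm hec⟩
    rw [Function.update_of_ne hvz]
    by_cases hv : f v ∈ acc G f a
    · rw [recol_acc hv]
    have h1 : f v ≠ e := by rintro rfl; exact hv he
    refine ⟨fun h => absurd h h1, fun h => ?_⟩
    by_cases hvy : v = y
    · subst hvy
      rw [recol_y hyB] at h
      exact absurd h.symm hez
    · rw [recol_B hv hvy] at h
      exact absurd he (h ▸ hg1' v hv hvy)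
  rcases hcase with ⟨c, hc, hcz, hm⟩ | ⟨hnm, y₂, hy₂, hy₂y, hnadj⟩
  · have hm' : Mov G (recol G f a g z y) z c := by
      intro v hv
      by_cases hv2 : f v ∈ acc G f a
      · rw [recol_acc hv2] at hv; exact hm v hv
      by_cases hvy : v = y
      · subst hvy
        rw [recol_y hyB] at hv
        exact absurd hv.symm hcz
      · rw [recol_B hv2 hvy] at hv
        exact absurd hc (hv ▸ hg1' v hv2 hvy)
    obtain ⟨hp', hs'⟩ := hmain c hm'
    refine shift _ {f z} _ c rfl hp' hs' ?_
    refine (hterm (f z) hzA c hc hcz).congr' ?_ ?_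
    · intro e hec he
      exact hsame c e hec (by simpa using he.notMem) (mem_acc.2 (he.mono (by simp)))
    · intro v hv
      have hvz : v ≠ z := by rintro rfl; exact hcz hv.symm
      rw [Function.update_of_ne hvz, recol_acc (hv ▸ hc), hv]
  · have hex : ∃ c ∈ (acc G f a)ᶜ, c ∉ ({v ∈ X | G.Adj z v} : Finset V).image g := by
      apply exists_mem_notMem_of_card_lt_card
      refine lt_of_le_of_lt card_image_le ?_
      have h1 := le_nb (G := G) (f := f) (x := z) (P := (acc G f a).erase (f z))
        fun c hc => hnm c (mem_of_mem_erase hc) (ne_of_mem_erase hc)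
      have h2 := nb_add (G := G) (f := f) (x := z)
        (disjoint_compl_right.mono_left (erase_subset (f z) (acc G f a)))
      rw [card_erase_of_mem hzacc] at h1
      have h3 : 0 < #(acc G f a) := card_pos.2 ⟨_, hzacc⟩
      have h4 := hΔ z
      have h5 := card_add_card_compl (acc G f a)
      have h6 : ({v ∈ X | G.Adj z v} : Finset V) ⊂ nb G f z (acc G f a)ᶜ := by
        refine ⟨?_, fun h => ?_⟩
        · intro v hv
          rw [mem_filter, hXm] at hv
          exact mem_nb.2 ⟨mem_compl.2 hv.1.1, hv.2⟩
        · have := h (mem_nb.2 ⟨mem_compl.2 hyB, hadj⟩)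
          rw [mem_filter, hXm] at this
          exact this.1.2 rfl
      have h7 := card_lt_card h6
      omega
    obtain ⟨c, hcB, hcg⟩ := hex
    rw [mem_compl] at hcB
    have hcz : c ≠ f z := by rintro rfl; exact hcB hzacc
    have hm' : Mov G (recol G f a g z y) z c := by
      intro v hv hadjv
      by_cases hv2 : f v ∈ acc G f a
      · rw [recol_acc hv2] at hv; exact hcB (hv ▸ hv2)
      by_cases hvy : v = y
      · subst hvy
        rw [recol_y hyB] at hv
        exact absurd hv.symm hcz
      · rw [recol_B hv2 hvy] at hv
        exact hcg (mem_image.2 ⟨v, mem_filter.2 ⟨(hXm v).2 ⟨hv2, hvy⟩, hadjv⟩, hv⟩)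
    obtain ⟨hp', hs'⟩ := hmain c hm'
    set ψ := Function.update (recol G f a g z y) z c with hψ
    refine ih _ ?_ ψ c rfl hp' hs'
    rw [← hn]
    have hr1 : ∀ e, Reach G f a {f z} e → Reach G ψ a {f z} e := by
      intro e he
      refine he.congr ?_
      intro e' he'
      have he'' : e' ∈ acc G f a := mem_acc.2 (he'.mono (by simp))
      exact hsame c e' (by rintro rfl; exact hcB he'') (by simpa using he'.notMem) he''
    have hrW : Reach G ψ a ∅ (f z) := by
      obtain ⟨d, ⟨x, hx, hxm⟩, hd⟩ := (mem_acc.1 hzacc).leave hza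
      have hd' : Reach G f a {f z} d := by simpa using hd
      have hdz : d ≠ f z := by simpa using hd'.notMem
      have hdacc : d ∈ acc G f a := mem_acc.2 (hd'.mono (by simp))
      have hxz : x ≠ z := by
        rintro rfl
        exact hnm d hdacc hdz hxm
      refine .step (by simp) ⟨x, ?_, ?_⟩ ((hr1 d hd').mono (by simp))
      · rw [hψ, Function.update_of_ne hxz, recol_acc (hx ▸ hzacc), hx]
      · intro v hv
        exact hxm v ((hsame c d (by rintro rfl; exact hcB hdacc) hdz hdacc v).2 hv)
    have hy₂B := hy₂.2.1
    have hy₂z : y₂ ≠ z := by rintro rfl; exact hy₂B hzacc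
    have hry : Reach G ψ a ∅ (g y₂) := by
      refine .step (by simp) ⟨y₂, ?_, ?_⟩ hrW
      · rw [hψ, Function.update_of_ne hy₂z, recol_B hy₂B hy₂y]
      · intro v hv hadjv
        by_cases hvz : v = z
        · subst hvz
          rw [hψ, Function.update_self] at hv
          exact hcz hv
        rw [hψ, Function.update_of_ne hvz] at hv
        by_cases hv2 : f v ∈ acc G f a
        · rw [recol_acc hv2] at hv
          exact hvz (hy₂.2.2.2 v hv hadjv.symm)
        by_cases hvy : v = y
        · subst hvy; exact hnadj hadjv.symm
        · rw [recol_B hv2 hvy] at hv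
          exact hg1' v hv2 hvy (hv ▸ hzacc)
    apply card_lt_card
    rw [ssubset_iff_subset_ne, compl_subset_compl]
    constructor
    · intro e he
      rw [mem_acc]
      by_cases hez : e = f z
      · rw [hez]; exact hrW
      · exact (hr1 e (hterm (f z) hzA e he hez)).mono (by simp)
    · intro h
      have h1 : g y₂ ∈ acc G ψ a := mem_acc.2 hry
      rw [compl_injective h] at h1
      exact hg1' y₂ hy₂B hy₂y h1

end

theorem hs_main (k : ℕ) : ∀ (V : Type u) (ι : Type v) [Fintype V] [Fintype ι]
    (G : SimpleGraph V) (s : ℕ), Fintype.card ι = k → Fintype.card V = k * s →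
    (∀ x, #{y | G.Adj x y} < k) → Equit G ι s := by
  induction k using Nat.strong_induction_on with
  | _ k ih =>
  intro V ι _ _ G s hk hV
  have hsub : ∀ G : SimpleGraph V, SubHS G ι s := by
    intro G Q hQ X hX hd
    have hQk : #Q < k := by
      rw [← hk]; exact card_lt_univ_of_notMem (x := (by
        have : ∃ x, x ∉ Q := by
          by_contra! h
          exact hQ (eq_univ_iff_forall.2 h)
        exact this.choose)) (by
        have : ∃ x, x ∉ Q := by
          by_contra! h
          exact hQ (eq_univ_iff_forall.2 h)
        exact this.choose_spec)
    obtain ⟨g, hg1, hg2⟩ := ih #Q hQk X Q (G.comap Subtype.val) s (by simp) (by simpa using hX) (by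
      intro x
      refine lt_of_le_of_lt ?_ (hd x x.2)
      rw [← card_map (Function.Embedding.subtype _)]
      apply card_le_card
      intro w hw
      simp only [mem_map, mem_filter, mem_univ, true_and] at hw
      obtain ⟨w', h1, rfl⟩ := hw
      exact mem_filter.2 ⟨w'.2, h1⟩)
    have hQne : X.Nonempty → Q.Nonempty := by
      rintro ⟨x, hx⟩
      exact ⟨_, (g ⟨x, hx⟩).2⟩
    by_cases hι : Nonempty ι
    swap
    · rw [not_nonempty_iff] at hι
      exact absurd (Subsingleton.elim _ _) hQ
    refine ⟨fun v => if h : v ∈ X then (g ⟨v, h⟩ : ι) else Classical.arbitrary ι, ?_, ?_, ?_⟩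
    · intro v hv
      simp [hv]
    · intro v hv w hw hvw
      simp only [hv, hw, dif_pos]
      intro h
      exact hg1 ⟨v, hv⟩ ⟨w, hw⟩ hvw (Subtype.ext h)
    · intro c hc
      rw [← hg2 ⟨c, hc⟩, ← card_map (Function.Embedding.subtype _)]
      congr 1
      ext v
      simp only [mem_map, mem_filter, mem_univ, true_and]
      constructor
      · rintro ⟨h1, h2⟩
        rw [dif_pos h1] at h2
        exact ⟨⟨v, h1⟩, Subtype.ext h2, rfl⟩
      · rintro ⟨w, h1, rfl⟩
        refine ⟨w.2, ?_⟩
        simp [h1]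
  generalize hn : #G.edgeFinset = n
  induction n using Nat.strong_induction_on generalizing G with
  | _ n ihn =>
  intro hΔ
  by_cases hE : ∃ u v, G.Adj u v
  · obtain ⟨u, v, huv⟩ := hE
    have hlt : #(G.deleteEdges {s(u, v)}).edgeFinset < n := by
      rw [← hn]
      apply card_lt_card
      rw [SimpleGraph.edgeFinset_ssubset_edgeFinset]
      refine lt_of_le_of_ne (SimpleGraph.deleteEdges_le _) ?_
      intro h
      have : (G.deleteEdges {s(u, v)}).Adj u v := by rw [h]; exact huv
      simp [SimpleGraph.deleteEdges_adj] at this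
    obtain ⟨f, hf1, hf2⟩ := ihn _ hlt (G.deleteEdges {s(u, v)}) (by congr!) (by
      intro x
      refine lt_of_le_of_lt ?_ (hΔ x)
      apply card_le_card
      intro w
      simp only [mem_filter, mem_univ, true_and]
      exact fun h => SimpleGraph.deleteEdges_le _ h)
    have hf1' : ∀ x y, G.Adj x y → s(x, y) ≠ s(u, v) → f x ≠ f y := by
      intro x y hxy hne
      exact hf1 x y (by rw [SimpleGraph.deleteEdges_adj]; exact ⟨hxy, by simpa using hne⟩)
    by_cases hfe : f u = f v
    · have hex : ∃ c, c ≠ f u ∧ Mov G f u c := by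
        by_contra! hcon
        have h1 := le_nb (G := G) (f := f) (x := u) (P := univ) (by
          intro c _
          by_cases hc : c = f u
          · intro h
            exact h v (by rw [hc, hfe]) huv
          · exact hcon c hc)
        have h2 : #(nb G f u univ) ≤ #{y | G.Adj u y} := by
          apply card_le_card; intro y; simp [mem_nb]
        have h3 := hΔ u
        rw [card_univ] at h1
        omega
      obtain ⟨c, hc, hm⟩ := hex
      refine nearly (a := f u) (by rw [hk]; exact hΔ) (hsub G) _ (Function.update f u c) c rfl ?_ ?_
      · intro x y hxy
        by_cases hx : x = u
        · subst hx
          rw [Function.update_self, Function.update_of_ne hxy.ne']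
          intro h; exact hm y h.symm hxy
        by_cases hy : y = u
        · subst hy
          rw [Function.update_self, Function.update_of_ne hxy.ne]
          intro h; exact hm x h hxy.symm
        rw [Function.update_of_ne hx, Function.update_of_ne hy]
        refine hf1' x y hxy ?_
        intro h
        have : u ∈ s(x, y) := by rw [h]; simp
        rw [Sym2.mem_iff] at this
        rcases this with h | h
        · exact hx h.symm
        · exact hy h.symm
      · intro e
        have h1 := card_update f u c e
        rw [hf2 e] at h1
        rw [eq_comm (a := e), eq_comm (a := e) (b := c)]
        exact h1
    · refine ⟨f, ?_, hf2⟩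
      intro x y hxy
      by_cases h : s(x, y) = s(u, v)
      · rw [Sym2.eq_iff] at h
        rcases h with ⟨rfl, rfl⟩ | ⟨rfl, rfl⟩
        · exact hfe
        · exact fun h => hfe h.symm
      · exact hf1' x y hxy h
  · push Not at hE
    have hc : Fintype.card V = Fintype.card (ι × Fin s) := by simp [hV, hk]
    obtain ⟨e⟩ := Fintype.card_eq.1 hc
    refine ⟨fun v => (e v).1, fun u v h => absurd h (hE u v), ?_⟩
    intro c
    have hinj : Function.Injective fun i : Fin s => e.symm (c, i) := by
      intro i j h
      simpa using h
    have : ({v | (e v).1 = c} : Finset V) = (univ : Finset (Fin s)).image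
        fun i => e.symm (c, i) := by
      ext v
      simp only [mem_filter, mem_univ, true_and, mem_image]
      constructor
      · rintro rfl
        exact ⟨(e v).2, by simp⟩
      · rintro ⟨i, rfl⟩
        simp
    rw [this, card_image_of_injective _ hinj]
    simp

end HSz

theorem stmt7_aux {r : ℕ} {V : Type*} [Fintype V] (G : SimpleGraph V) (m : ℕ)
    (hm1 : m * r ≤ Fintype.card V)
    (hd : ∀ v : V, (open scoped Classical in Finset.card {w | ¬ G.Adj v w}) ≤ m) :
    ∃ F : Fin m → Finset V, (∀ i, G.IsNClique r (F i)) ∧ ∀ i j, i ≠ j → Disjoint (F i) (F j) := by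
  classical
  obtain ⟨X, -, hX⟩ := Finset.exists_subset_card_eq (s := (Finset.univ : Finset V)) (n := m * r)
    (by simpa using hm1)
  obtain ⟨f, hf1, hf2⟩ := HSz.hs_main m X (Fin m) (Gᶜ.comap Subtype.val) r (by simp)
    (by simpa using hX) (by
      intro x
      refine lt_of_lt_of_le ?_ (hd x)
      rw [← Finset.card_map (Function.Embedding.subtype _)]
      apply Finset.card_lt_card
      refine ⟨?_, fun h => ?_⟩
      · intro w hw
        simp only [Finset.mem_map, Finset.mem_filter, Finset.mem_univ, true_and] at hw ⊢
        obtain ⟨w', h1, rfl⟩ := hw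
        simp only [SimpleGraph.comap_adj, SimpleGraph.compl_adj] at h1
        exact h1.2
      · have hx : (x : V) ∈ _ := h (by simp)
        simp at hx)
  refine ⟨fun i => (Finset.univ.filter fun v => f v = i).map (Function.Embedding.subtype _), ?_, ?_⟩
  · intro i
    rw [SimpleGraph.isNClique_iff]
    constructor
    · intro u hu v hv huv
      simp only [Finset.coe_map, Set.mem_image, Finset.mem_coe, Finset.mem_filter,
        Finset.mem_univ, true_and] at hu hv
      obtain ⟨u, hu, rfl⟩ := hu
      obtain ⟨v, hv, rfl⟩ := hv
      by_contra hcon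
      exact hf1 u v (by
        simp only [SimpleGraph.comap_adj, SimpleGraph.compl_adj]
        exact ⟨huv, hcon⟩) (hu.trans hv.symm)
    · rw [Finset.card_map]
      convert hf2 i
  · intro i j hij
    rw [Finset.disjoint_left]
    intro v hv hv'
    simp only [Finset.mem_map, Finset.mem_filter, Finset.mem_univ, true_and] at hv hv'
    obtain ⟨u, hu, rfl⟩ := hv
    obtain ⟨w, hw, h⟩ := hv'
    have : w = u := Subtype.ext h
    subst this
    exact hij (hu.symm.trans hw)

/-- Corollary of the Hajnal–Szemerédi theorem: an `n`-vertex graph with minimum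
degree at least `(1 - 1/r)n` contains vertex-disjoint copies of `K_r` covering
all but at most `r - 1` vertices. -/
theorem stmt7 {r n : ℕ} (hr : 0 < r) {V : Type*} [Fintype V] [DecidableEq V]
    (G : SimpleGraph V) [DecidableRel G.Adj] (hV : Fintype.card V = n)
    (hδ : ∀ v : V, (1 - 1 / (r : ℝ)) * n ≤ G.degree v) :
    ∃ 𝒞 : Finset (Finset V),
      (∀ s ∈ 𝒞, G.IsNClique r s) ∧
      (𝒞 : Set (Finset V)).Pairwise (fun s t => Disjoint s t) ∧
      n ≤ (𝒞.biUnion id).card + (r - 1) := by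
  classical
  have hmod := Nat.div_add_mod n r
  have hlt := Nat.mod_lt n hr
  obtain ⟨F, hF1, hF2⟩ := stmt7_aux G (n / r) (by rw [hV]; exact Nat.div_mul_le_self n r) (by
    intro v
    have h1 := hδ v
    have h2 : Finset.card {w | ¬ G.Adj v w} + G.degree v = n := by
      rw [← hV, ← Finset.card_univ,
        ← Finset.card_filter_add_card_filter_not (s := Finset.univ) (fun w => G.Adj v w), add_comm,
        ← SimpleGraph.card_neighborFinset_eq_degree, SimpleGraph.neighborFinset_eq_filter]
    rw [Nat.le_div_iff_mul_le hr]
    have hr' : (0 : ℝ) < r := by exact_mod_cast hr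
    have h3 : ((Finset.card {w | ¬ G.Adj v w} : ℕ) : ℝ) + G.degree v = n := by exact_mod_cast h2
    have h4 : ((Finset.card {w | ¬ G.Adj v w} : ℕ) : ℝ) ≤ n / r := by
      have : (1 - 1 / (r : ℝ)) * n = n - n / r := by ring
      linarith
    rw [le_div_iff₀ hr'] at h4
    have h5 : Finset.card {w | ¬ G.Adj v w} * r ≤ n := by exact_mod_cast h4
    convert h5)
  have hinj : Function.Injective F := by
    intro i j hij
    by_contra hne
    have h1 := hF2 i j hne
    rw [hij, disjoint_self] at h1
    have h2 := (hF1 j).card_eq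
    rw [h1] at h2
    simp at h2
    omega
  refine ⟨Finset.univ.image F, ?_, ?_, ?_⟩
  · intro s hs
    obtain ⟨i, -, rfl⟩ := Finset.mem_image.1 hs
    exact hF1 i
  · intro s hs t ht hst
    simp only [Finset.coe_image, Finset.coe_univ, Set.image_univ, Set.mem_range] at hs ht
    obtain ⟨i, rfl⟩ := hs
    obtain ⟨j, rfl⟩ := ht
    exact hF2 i j fun h => hst (by rw [h])
  · have : ((Finset.univ.image F).biUnion id).card = n / r * r := by
      rw [Finset.image_biUnion]
      simp only [id]
      rw [Finset.card_biUnion (fun i _ j _ h => hF2 i j h)]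
      simp [(hF1 _).card_eq]
    rw [this, mul_comm]
    omega
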